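/- arXiv:2009.10988 — 2 statements merged into one kernel-verified Lean document; each statement's English description precedes it below -/
import Mathlib

section
/- For n = 16 agents, the tree connection game admits no pure Nash equilibrium: for every strategy profile s there exists an agent who can strictly decrease her cost by unilaterally changing her strategy. -/
open Function
open scoped ENNReal Classical

noncomputable section

namespace TCG

variable {n : ℕ}

/-- In-degree of node `v` in the network induced by profile `s` with root `r`:
the number of activated edges `(u, v)` with `u` an agent (a non-root node). -/
def indeg (r : Fin (n + 1)) (s : Fin (n + 1) → Fin (n + 1)) (v : Fin (n + 1)) : ℕ :=
  Nat.card {u : Fin (n + 1) | u ≠ r ∧ s u = v}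

/-- `|T(u)|`: the number of nodes having a directed path to `u` (including `u` itself). -/
def subtreeSize (s : Fin (n + 1) → Fin (n + 1)) (u : Fin (n + 1)) : ℕ :=
  Nat.card {w : Fin (n + 1) | ∃ k, s^[k] w = u}

/-- Cost of the agent at node `v` with respect to the root `r`:
the sum, over the edges `(u, u')` of the unique directed path from `v` to `r`,
of `indeg(u') / |T(u)|`; the cost is `∞` if no such path exists. -/
def cost (r : Fin (n + 1)) (s : Fin (n + 1) → Fin (n + 1)) (v : Fin (n + 1)) : ℝ≥0∞ :=
  if h : ∃ k, s^[k] v = r then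
    ∑ k ∈ Finset.range (Nat.find h),
      (indeg r s (s^[k + 1] v) : ℝ≥0∞) / (subtreeSize s (s^[k] v) : ℝ≥0∞)
  else ⊤

/-- A valid strategy profile: the root is absorbing (a formal convention encoding that the
root activates no edge), and every agent chooses a node different from herself. -/
def ValidProfile (r : Fin (n + 1)) (s : Fin (n + 1) → Fin (n + 1)) : Prop :=
  s r = r ∧ ∀ v, v ≠ r → s v ≠ v

/-- Pure Nash equilibrium (the induced network is *stable*): no agent can strictly
decrease her cost by unilaterally switching her activated edge to another node. -/
def IsStable (r : Fin (n + 1)) (s : Fin (n + 1) → Fin (n + 1)) : Prop :=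
  ValidProfile r s ∧
    ∀ v, v ≠ r → ∀ w, w ≠ v → cost r s v ≤ cost r (Function.update s v w) v

/-- Social cost: the sum of the costs of all agents (the non-root nodes). -/
def SC (s : Fin (n + 1) → Fin (n + 1)) : ℝ≥0∞ :=
  ∑ v ∈ Finset.univ.erase (0 : Fin (n + 1)), cost 0 s v

/-- Height of the induced network: the maximum length of a (leaf-to-)root path,
i.e. the least `k` such that every node arrives at the root after `k` steps. -/
def height (s : Fin (n + 1) → Fin (n + 1)) : ℕ :=
  sInf {k | ∀ v, s^[k] v = 0}

/-- Fairness Ratio: maximum agent cost divided by minimum agent cost. -/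
def FR (s : Fin (n + 1) → Fin (n + 1)) : ℝ≥0∞ :=
  (⨆ (v : Fin (n + 1)) (_ : v ≠ 0), cost 0 s v) /
    (⨅ (v : Fin (n + 1)) (_ : v ≠ 0), cost 0 s v)

variable {s : Fin (n + 1) → Fin (n + 1)}

/-- There is a directed path from `w` to `u`. -/
def Reach (s : Fin (n + 1) → Fin (n + 1)) (w u : Fin (n + 1)) : Prop := ∃ k, s^[k] w = u

lemma Reach.refl (u : Fin (n + 1)) : Reach s u u := ⟨0, rfl⟩

lemma Reach.trans {a b c : Fin (n + 1)} (hab : Reach s a b) (hbc : Reach s b c) :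
    Reach s a c := by
  obtain ⟨i, rfl⟩ := hab
  obtain ⟨j, rfl⟩ := hbc
  exact ⟨j + i, iterate_add_apply s j i a⟩

lemma Reach.next (u : Fin (n + 1)) : Reach s u (s u) := ⟨1, rfl⟩

lemma Reach.eq_or_next {a b : Fin (n + 1)} (h : Reach s a b) : a = b ∨ Reach s (s a) b := by
  obtain ⟨k, hk⟩ := h
  cases k with
  | zero => exact .inl hk
  | succ k => exact .inr ⟨k, hk⟩

lemma Reach.total {w a b : Fin (n + 1)} (ha : Reach s w a) (hb : Reach s w b) :
    Reach s a b ∨ Reach s b a := by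
  obtain ⟨i, rfl⟩ := ha
  obtain ⟨j, rfl⟩ := hb
  rcases le_total i j with h | h
  · exact .inl ⟨j - i, by rw [← iterate_add_apply, Nat.sub_add_cancel h]⟩
  · exact .inr ⟨i - j, by rw [← iterate_add_apply, Nat.sub_add_cancel h]⟩

/-- The profile `s` induces a tree directed towards the root `0`. -/
structure IsTree (s : Fin (n + 1) → Fin (n + 1)) : Prop where
  root : s 0 = 0
  reach : ∀ u, Reach s u 0

lemma IsTree.iterate_root (hs : IsTree s) (k : ℕ) : s^[k] 0 = 0 := iterate_fixed hs.root k

lemma IsTree.antisymm (hs : IsTree s) {a b : Fin (n + 1)} (hab : Reach s a b)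
    (hba : Reach s b a) : a = b := by
  obtain ⟨i, hi⟩ := hab
  obtain ⟨j, hj⟩ := hba
  obtain ⟨k, hk⟩ := hs.reach a
  have hper : s^[j + i] a = a := by rw [iterate_add_apply, hi, hj]
  rcases Nat.eq_zero_or_pos (j + i) with h | h
  · obtain rfl : i = 0 := by omega
    exact hi
  · have ha : s^[k * (j + i)] a = a := IsPeriodicPt.const_mul (f := s) (x := a) hper k
    have hle : k ≤ k * (j + i) := Nat.le_mul_of_pos_right k h
    have ha0 : a = 0 := by
      rw [← ha, ← Nat.sub_add_cancel hle, iterate_add_apply, hk, hs.iterate_root]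
    rw [ha0, hs.iterate_root] at hi
    rw [ha0, hi]

lemma IsTree.not_reach_next (hs : IsTree s) {c : Fin (n + 1)} (hc : c ≠ 0) :
    ¬ Reach s (s c) c := by
  intro h
  have hfix : s c = c := hs.antisymm h (Reach.next c)
  obtain ⟨k, hk⟩ := hs.reach c
  exact hc (by rw [← hk, iterate_fixed hfix])

lemma IsTree.not_reach_siblings (hs : IsTree s) {c d : Fin (n + 1)} (hd : d ≠ 0)
    (hcd : s c = s d) (hne : c ≠ d) : ¬ Reach s c d := by
  intro h
  rcases h.eq_or_next with h | h
  · exact hne h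
  · exact hs.not_reach_next hd (hcd ▸ h)

lemma IsTree.not_reach_both (hs : IsTree s) {c d w : Fin (n + 1)} (hc : c ≠ 0) (hd : d ≠ 0)
    (hcd : s c = s d) (hne : c ≠ d) (hwc : Reach s w c) : ¬ Reach s w d := by
  intro hwd
  rcases hwc.total hwd with h | h
  · exact hs.not_reach_siblings hd hcd hne h
  · exact hs.not_reach_siblings hc hcd.symm hne.symm h

/-- The agents whose strategy is `u`. -/
def children (s : Fin (n + 1) → Fin (n + 1)) (u : Fin (n + 1)) : Finset (Fin (n + 1)) :=
  {c | c ≠ 0 ∧ s c = u}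

/-- The nodes of the subtree at `u`. -/
def subtree (s : Fin (n + 1) → Fin (n + 1)) (u : Fin (n + 1)) : Finset (Fin (n + 1)) :=
  {w | Reach s w u}

@[simp] lemma mem_children {u c : Fin (n + 1)} : c ∈ children s u ↔ c ≠ 0 ∧ s c = u := by
  simp [children]

@[simp] lemma mem_subtree {u w : Fin (n + 1)} : w ∈ subtree s u ↔ Reach s w u := by
  simp [subtree]

lemma indeg_eq_card (u : Fin (n + 1)) : indeg 0 s u = (children s u).card := by
  rw [indeg, ← Nat.card_eq_finsetCard]
  exact Nat.card_congr (Equiv.subtypeEquivRight fun c => by simp)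

lemma subtreeSize_eq_card (u : Fin (n + 1)) : subtreeSize s u = (subtree s u).card := by
  rw [subtreeSize, ← Nat.card_eq_finsetCard]
  exact Nat.card_congr (Equiv.subtypeEquivRight fun c => by simp [Reach])

lemma subtreeSize_pos (u : Fin (n + 1)) : 0 < subtreeSize s u := by
  rw [subtreeSize_eq_card]
  exact Finset.card_pos.2 ⟨u, mem_subtree.2 (Reach.refl u)⟩

lemma IsTree.subtreeSize_root (hs : IsTree s) : subtreeSize s 0 = n + 1 := by
  rw [subtreeSize_eq_card, Finset.eq_univ_of_forall fun w => mem_subtree.2 (hs.reach w),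
    Finset.card_univ, Fintype.card_fin]

lemma IsTree.eq_of_subtreeSize_eq (hs : IsTree s) {x c : Fin (n + 1)} (h : Reach s x c)
    (hsize : subtreeSize s x = subtreeSize s c) : x = c := by
  rw [subtreeSize_eq_card, subtreeSize_eq_card] at hsize
  have hsub : subtree s x ⊆ subtree s c := fun w hw =>
    mem_subtree.2 ((mem_subtree.1 hw).trans h)
  have hcx : Reach s c x := by
    rw [← mem_subtree, Finset.eq_of_subset_of_card_le hsub hsize.ge]
    exact mem_subtree.2 (Reach.refl c)
  exact hs.antisymm h hcx

lemma IsTree.eq_or_exists_child (hs : IsTree s) {w u : Fin (n + 1)} (h : Reach s w u) :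
    w = u ∨ ∃ c ∈ children s u, Reach s w c := by
  obtain ⟨k, hk⟩ := h
  induction k with
  | zero => exact .inl hk
  | succ k ih =>
    rw [iterate_succ_apply'] at hk
    by_cases hc : s^[k] w = 0
    · rw [hc, hs.root] at hk
      exact ih (hc.trans hk)
    · exact .inr ⟨s^[k] w, mem_children.2 ⟨hc, hk⟩, k, rfl⟩

lemma IsTree.subtreeSize_eq (hs : IsTree s) (u : Fin (n + 1)) :
    subtreeSize s u = ∑ c ∈ children s u, subtreeSize s c + 1 := by
  have hdecomp : subtree s u = insert u ((children s u).biUnion (subtree s)) := by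
    ext w
    simp only [mem_subtree, Finset.mem_insert, Finset.mem_biUnion]
    refine ⟨hs.eq_or_exists_child, ?_⟩
    rintro (rfl | ⟨c, hc, hw⟩)
    · exact Reach.refl w
    · exact (mem_children.1 hc).2 ▸ hw.trans (Reach.next c)
  have hu : u ∉ (children s u).biUnion (subtree s) := by
    simp only [Finset.mem_biUnion, mem_subtree, mem_children]
    rintro ⟨c, ⟨hc, rfl⟩, h⟩
    exact hs.not_reach_next hc h
  rw [subtreeSize_eq_card, hdecomp, Finset.card_insert_of_notMem hu, Finset.card_biUnion]
  · simp_rw [subtreeSize_eq_card]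
  · intro c hc d hd hne
    rw [Finset.mem_coe, mem_children] at hc hd
    refine Finset.disjoint_left.2 fun w hwc hwd => ?_
    exact hs.not_reach_both hc.1 hd.1 (hc.2.trans hd.2.symm) hne
      (mem_subtree.1 hwc) (mem_subtree.1 hwd)

/-! ### Costs -/

lemma cost_root : cost 0 s 0 = 0 := by
  have h : ∃ k, s^[k] 0 = 0 := ⟨0, rfl⟩
  have h0 : Nat.find h = 0 := (Nat.find_eq_zero h).2 rfl
  rw [cost, dif_pos h, h0, Finset.range_zero, Finset.sum_empty]

lemma cost_step {u : Fin (n + 1)} (hu : u ≠ 0) (h : Reach s u 0) :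
    cost 0 s u = (indeg 0 s (s u) : ℝ≥0∞) / (subtreeSize s u : ℝ≥0∞) + cost 0 s (s u) := by
  have h' : ∃ k, s^[k + 1] u = 0 := h.eq_or_next.resolve_left hu
  have h : ∃ k, s^[k] u = 0 := h
  have hfind : Nat.find h = Nat.find h' + 1 := Nat.find_comp_succ h h' hu
  have hnext : ∃ k, s^[k] (s u) = 0 := h'
  rw [cost, dif_pos h, hfind, Finset.sum_range_succ', add_comm, cost, dif_pos hnext]
  rfl

lemma cost_ne_top {u : Fin (n + 1)} (h : Reach s u 0) : cost 0 s u ≠ ⊤ := by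
  have h : ∃ k, s^[k] u = 0 := h
  rw [cost, dif_pos h]
  refine ENNReal.sum_ne_top.2 fun k _ => ENNReal.div_ne_top (ENNReal.natCast_ne_top _) ?_
  exact Nat.cast_ne_zero.2 (subtreeSize_pos _).ne'

/-- The cost as a real number. -/
def realCost (s : Fin (n + 1) → Fin (n + 1)) (u : Fin (n + 1)) : ℝ := (cost 0 s u).toReal

lemma realCost_root : realCost s 0 = 0 := by simp [realCost, cost_root]

lemma IsTree.realCost_eq (hs : IsTree s) {u : Fin (n + 1)} (hu : u ≠ 0) :
    realCost s u = indeg 0 s (s u) / subtreeSize s u + realCost s (s u) := by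
  rw [realCost, cost_step hu (hs.reach u), ENNReal.toReal_add _ (cost_ne_top (hs.reach _)),
    ENNReal.toReal_div, ENNReal.toReal_natCast, ENNReal.toReal_natCast, realCost]
  exact ENNReal.div_ne_top (ENNReal.natCast_ne_top _) (Nat.cast_ne_zero.2 (subtreeSize_pos _).ne')

/-! ### Fractions -/

/-- The sum of two fractions, given by their numerators and denominators. -/
def fracAdd (p q : ℕ × ℕ) : ℕ × ℕ := (p.1 * q.2 + q.1 * p.2, p.2 * q.2)

/-- The strict comparison of two fractions with positive denominators. -/
def fracLT (p q : ℕ × ℕ) : Bool := Nat.blt (p.1 * q.2) (q.1 * p.2)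

/-- The value of a fraction. -/
def fracVal (p : ℕ × ℕ) : ℝ := p.1 / p.2

lemma fracAdd_snd_pos {p q : ℕ × ℕ} (hp : 0 < p.2) (hq : 0 < q.2) : 0 < (fracAdd p q).2 :=
  Nat.mul_pos hp hq

lemma fracVal_fracAdd {p q : ℕ × ℕ} (hp : 0 < p.2) (hq : 0 < q.2) :
    fracVal (fracAdd p q) = fracVal p + fracVal q := by
  have hp' : (p.2 : ℝ) ≠ 0 := by exact_mod_cast hp.ne'
  have hq' : (q.2 : ℝ) ≠ 0 := by exact_mod_cast hq.ne'
  simp only [fracVal, fracAdd]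
  push_cast
  field_simp

lemma fracVal_lt {p q : ℕ × ℕ} (hp : 0 < p.2) (hq : 0 < q.2) (h : fracLT p q = true) :
    fracVal p < fracVal q := by
  rw [fracLT, Nat.blt_eq] at h
  rw [fracVal, fracVal, div_lt_div_iff₀ (by exact_mod_cast hp) (by exact_mod_cast hq)]
  exact_mod_cast h

/-! ### Deviations -/

lemma reach_update_aux {x y w u : Fin (n + 1)} (h : Reach s w u) :
    Reach (update s x y) w u ∨ Reach s w x ∧ Reach (update s x y) w x := by
  obtain ⟨k, hk⟩ := h
  induction k generalizing w with
  | zero => exact .inl ⟨0, hk⟩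
  | succ k ih =>
    by_cases hw : w = x
    · subst hw
      exact .inr ⟨Reach.refl w, Reach.refl w⟩
    · have hstep : Reach (update s x y) w (s w) :=
        ⟨1, (iterate_one _).symm ▸ update_of_ne hw y s⟩
      rcases ih (w := s w) hk with h | ⟨h, h'⟩
      · exact .inl (hstep.trans h)
      · exact .inr ⟨(Reach.next w).trans h, hstep.trans h'⟩

lemma Reach.update_of_reach {x y w : Fin (n + 1)} (h : Reach s w x) :
    Reach (update s x y) w x := by
  rcases reach_update_aux (y := y) h with h | h
  · exact h
  · exact h.2

lemma Reach.update_of_not {x y w u : Fin (n + 1)} (h : Reach s w u) (hw : ¬ Reach s w x) :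
    Reach (update s x y) w u :=
  (reach_update_aux h).resolve_right fun h => hw h.1

lemma Reach.update_join {x y w u : Fin (n + 1)} (hyx : ¬ Reach s y x) (hyu : Reach s y u)
    (hwx : Reach s w x) : Reach (update s x y) w u :=
  hwx.update_of_reach.trans <| Reach.trans
    ⟨1, (iterate_one _).symm ▸ update_self x y s⟩ (hyu.update_of_not hyx)

lemma Reach.update_above {x y w u : Fin (n + 1)} (hyx : ¬ Reach s y x) (hyu : Reach s y u)
    (hwu : Reach s w u) : Reach (update s x y) w u := by
  by_cases hwx : Reach s w x
  · exact .update_join hyx hyu hwx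
  · exact hwu.update_of_not hwx

lemma IsTree.update (hs : IsTree s) {x y : Fin (n + 1)} (hx : x ≠ 0) (hyx : ¬ Reach s y x) :
    IsTree (update s x y) where
  root := by rw [update_of_ne hx.symm, hs.root]
  reach u := .update_above hyx (hs.reach y) (hs.reach u)

lemma subtreeSize_le_update {x y u : Fin (n + 1)} (hyx : ¬ Reach s y x) (hyu : Reach s y u) :
    subtreeSize s u ≤ subtreeSize (update s x y) u := by
  rw [subtreeSize_eq_card, subtreeSize_eq_card]
  exact Finset.card_le_card fun w hw => mem_subtree.2 (.update_above hyx hyu (mem_subtree.1 hw))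

lemma subtreeSize_le_update_self (x y : Fin (n + 1)) :
    subtreeSize s x ≤ subtreeSize (update s x y) x := by
  rw [subtreeSize_eq_card, subtreeSize_eq_card]
  exact Finset.card_le_card fun w hw => mem_subtree.2 (mem_subtree.1 hw).update_of_reach

lemma subtreeSize_add_le_update {x y u : Fin (n + 1)} (hyx : ¬ Reach s y x)
    (hyu : Reach s y u) (hxu : ¬ Reach s x u) :
    subtreeSize s u + subtreeSize s x ≤ subtreeSize (update s x y) u := by
  have hdisj : Disjoint (subtree s u) (subtree s x) := by
    refine Finset.disjoint_left.2 fun w hwu hwx => ?_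
    rcases (mem_subtree.1 hwu).total (mem_subtree.1 hwx) with h | h
    · exact hyx (hyu.trans h)
    · exact hxu h
  simp only [subtreeSize_eq_card]
  rw [← Finset.card_union_of_disjoint hdisj]
  refine Finset.card_le_card fun w hw => mem_subtree.2 ?_
  rcases Finset.mem_union.1 hw with h | h
  · exact .update_above hyx hyu (mem_subtree.1 h)
  · exact .update_join hyx hyu (mem_subtree.1 h)

lemma indeg_update_le {x y u : Fin (n + 1)} (hu : u ≠ y) :
    indeg 0 (update s x y) u ≤ indeg 0 s u := by
  rw [indeg_eq_card, indeg_eq_card]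
  refine Finset.card_le_card fun c hc => ?_
  rw [mem_children] at hc ⊢
  have hcx : c ≠ x := by
    rintro rfl
    exact hu (by simpa using hc.2.symm)
  rwa [update_of_ne hcx] at hc

lemma indeg_update_add_one_le {x y : Fin (n + 1)} (hx : x ≠ 0) (hy : s x ≠ y) :
    indeg 0 (update s x y) (s x) + 1 ≤ indeg 0 s (s x) := by
  rw [indeg_eq_card, indeg_eq_card]
  refine Finset.card_lt_card <| Finset.ssubset_iff_of_subset (fun c hc => ?_) |>.2
    ⟨x, mem_children.2 ⟨hx, rfl⟩, ?_⟩
  · rw [mem_children] at hc ⊢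
    have hcx : c ≠ x := by
      rintro rfl
      exact hy (by simpa using hc.2.symm)
    rwa [update_of_ne hcx] at hc
  · simp [hy.symm]

lemma indeg_update_target_le (x y : Fin (n + 1)) :
    indeg 0 (update s x y) y ≤ indeg 0 s y + 1 := by
  rw [indeg_eq_card, indeg_eq_card]
  refine (Finset.card_le_card fun c hc => ?_).trans (Finset.card_insert_le x _)
  rw [Finset.mem_insert, mem_children]
  rw [mem_children] at hc
  by_cases hcx : c = x
  · exact .inl hcx
  · rw [update_of_ne hcx] at hc
    exact .inr hc

lemma natCast_div_le_div {a b c d : ℕ} (hab : a ≤ b) (hcd : d ≤ c) (hd : 0 < d) :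
    (a : ℝ) / c ≤ b / d :=
  div_le_div₀ (by positivity) (by exact_mod_cast hab) (by exact_mod_cast hd)
    (by exact_mod_cast hcd)

lemma IsTree.realCost_update_le (hs : IsTree s) {x y v : Fin (n + 1)} (hx : x ≠ 0)
    (hyx : ¬ Reach s y x) (hyv : Reach s y v) (hvx : ¬ Reach s v x) :
    realCost (Function.update s x y) v ≤ realCost s v := by
  obtain ⟨k, hk⟩ := hs.reach v
  induction k generalizing v with
  | zero =>
    obtain rfl : v = 0 := hk
    rw [realCost_root, realCost_root]
  | succ k ih =>
    by_cases hv : v = 0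
    · rw [hv, realCost_root, realCost_root]
    have hvx' : v ≠ x := by
      rintro rfl
      exact hvx (Reach.refl v)
    have hnext : ¬ Reach s (s v) x := fun h => hvx ((Reach.next v).trans h)
    rw [(hs.update hx hyx).realCost_eq hv, hs.realCost_eq hv, update_of_ne hvx']
    refine add_le_add (natCast_div_le_div (indeg_update_le ?_)
      (subtreeSize_le_update hyx hyv) (subtreeSize_pos v))
      (ih (hyv.trans (Reach.next v)) hnext hk)
    rintro rfl
    exact hs.not_reach_next hv hyv

lemma IsTree.realCost_update_self_le (hs : IsTree s) {x y : Fin (n + 1)} (hx : x ≠ 0)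
    (hyx : ¬ Reach s y x) :
    realCost (Function.update s x y) x ≤
      fracVal (indeg 0 s y + 1, subtreeSize s x) + realCost (Function.update s x y) y := by
  rw [(hs.update hx hyx).realCost_eq hx, Function.update_self]
  exact add_le_add_left (natCast_div_le_div (indeg_update_target_le x y)
    (subtreeSize_le_update_self x y) (subtreeSize_pos x)) _

/-! ### The stable trees -/

/-- The sizes of the subtrees at the children of `u`. -/
def childSizes (s : Fin (n + 1) → Fin (n + 1)) (u : Fin (n + 1)) : Multiset ℕ :=
  (children s u).val.map (subtreeSize s)

lemma indeg_eq_card_childSizes (u : Fin (n + 1)) : indeg 0 s u = (childSizes s u).card := by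
  rw [childSizes, Multiset.card_map, indeg_eq_card, Finset.card_val]

lemma exists_of_mem_childSizes {u : Fin (n + 1)} {b : ℕ} (h : b ∈ childSizes s u) :
    ∃ c, c ≠ 0 ∧ s c = u ∧ subtreeSize s c = b := by
  obtain ⟨c, hc, rfl⟩ := Multiset.mem_map.1 h
  obtain ⟨h0, hu⟩ := mem_children.1 (Finset.mem_val ▸ hc)
  exact ⟨c, h0, hu, rfl⟩

lemma exists_of_mem_childSizes_erase {u c : Fin (n + 1)} {b : ℕ} (hc : c ≠ 0) (hcu : s c = u)
    (h : b ∈ (childSizes s u).erase (subtreeSize s c)) :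
    ∃ d, d ≠ 0 ∧ s d = u ∧ d ≠ c ∧ subtreeSize s d = b := by
  have hmem : c ∈ (children s u).val := Finset.mem_val ▸ (mem_children.2 ⟨hc, hcu⟩)
  rw [childSizes, ← Multiset.map_erase_of_mem _ _ hmem] at h
  obtain ⟨d, hd, rfl⟩ := Multiset.mem_map.1 h
  rw [(children s u).nodup.mem_erase_iff] at hd
  obtain ⟨h0, hu⟩ := mem_children.1 (Finset.mem_val ▸ hd.2)
  exact ⟨d, h0, hu, hd.1, rfl⟩

/-- The sizes of the subtrees hanging from the root of the only stable tree with `m ≤ 16` nodes. -/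
def branches : ℕ → List ℕ
  | 2 => [1]
  | 3 => [2]
  | 4 => [3]
  | 5 => [2, 2]
  | 6 => [3, 2]
  | 7 => [3, 3]
  | 8 => [4, 3]
  | 9 => [4, 4]
  | 10 => [3, 3, 3]
  | 11 => [5, 5]
  | 12 => [6, 5]
  | 13 => [7, 5]
  | 14 => [7, 6]
  | 15 => [7, 7]
  | 16 => [5, 5, 5]
  | _ => []

/-- The nodes of the stable tree of size `a` down to depth less than `f`, each given by the cost of
its path to the root of that tree when `t` nodes are added below it, and the size of its subtree. -/
def below : ℕ → ℕ → ℕ → List ((ℕ × ℕ) × ℕ)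
  | 0, _, _ => []
  | f + 1, t, a => ((0, 1), a) :: (branches a).dedup.flatMap fun b =>
      (below f t b).map fun z => (fracAdd z.1 ((branches a).length, b + t), z.2)

/-- Some agent has an improving deviation within the tree whose root has the stable trees with
sizes `P` as its branches. -/
def improvable (P : List ℕ) : Bool :=
  P.any fun a => (below 16 0 a).any fun z =>
    Nat.blt z.2 a && fracLT (P.length + 1, z.2) (fracAdd z.1 (P.length, a)) ||
    (P.erase a).any fun b => (below 16 z.2 b).any fun w =>
      fracLT (fracAdd ((branches w.2).length + 1, z.2)
          (fracAdd w.1 (if z.2 = a then P.length - 1 else P.length, b + z.2)))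
        (fracAdd z.1 (P.length, a))

/-- The partitions of `n` into parts of size at most `k`. -/
def partitionsLE : ℕ → ℕ → List (List ℕ)
  | 0, n => if n = 0 then [[]] else []
  | k + 1, n => (List.range (n / (k + 1) + 1)).flatMap fun j =>
      (partitionsLE k (n - j * (k + 1))).map (List.replicate j (k + 1) ++ ·)

lemma partitions_complete :
    ∀ m ∈ List.range 17, ∀ P ∈ partitionsLE m m,
      improvable P = true ∨ m < 16 ∧ P = branches (m + 1) := by
  decide +kernel

lemma exists_mem_partitionsLE (k m : ℕ) (M : Multiset ℕ) (hM : ∀ a ∈ M, 0 < a ∧ a ≤ k)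
    (hsum : M.sum = m) : ∃ P ∈ partitionsLE k m, (P : Multiset ℕ) = M := by
  induction k generalizing m M with
  | zero =>
    have h0 : M = 0 := Multiset.eq_zero_of_forall_notMem fun a ha => by
      have := hM a ha
      omega
    subst h0
    obtain rfl : 0 = m := by simpa using hsum
    exact ⟨[], by simp [partitionsLE], rfl⟩
  | succ k ih =>
    have hsplit : Multiset.replicate (M.count (k + 1)) (k + 1) + M.filter (¬ (k + 1) = ·) = M := by
      rw [← Multiset.filter_eq, Multiset.filter_add_not]
    have hsum' : M.count (k + 1) * (k + 1) + (M.filter (¬ (k + 1) = ·)).sum = m := by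
      rw [← hsum]
      conv_rhs => rw [← hsplit]
      simp
    obtain ⟨P, hP, hPM⟩ := ih (m - M.count (k + 1) * (k + 1)) (M.filter (¬ (k + 1) = ·))
      (fun a ha => by
        obtain ⟨ha, hne⟩ := Multiset.mem_filter.1 ha
        have := hM a ha
        omega) (by omega)
    refine ⟨List.replicate (M.count (k + 1)) (k + 1) ++ P, ?_, ?_⟩
    · rw [partitionsLE, List.mem_flatMap]
      refine ⟨M.count (k + 1), ?_, List.mem_map.2 ⟨P, hP, rfl⟩⟩
      rw [List.mem_range, Nat.lt_succ_iff, Nat.le_div_iff_mul_le (Nat.add_pos_right k one_pos)]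
      omega
    · rw [← Multiset.coe_add, hPM, Multiset.coe_replicate, hsplit]

/-- All nodes whose subtree has fewer than `m` nodes have the children of the stable trees. -/
def StableBelow (s : Fin (n + 1) → Fin (n + 1)) (m : ℕ) : Prop :=
  ∀ u, subtreeSize s u < m → childSizes s u = branches (subtreeSize s u)

lemma StableBelow.indeg_eq {m : ℕ} (hm : StableBelow s m) {u : Fin (n + 1)}
    (hu : subtreeSize s u < m) : indeg 0 s u = (branches (subtreeSize s u)).length := by
  rw [indeg_eq_card_childSizes, hm u hu, Multiset.coe_card]

lemma IsTree.subtreeSize_lt (hs : IsTree s) {c : Fin (n + 1)} (hc : c ≠ 0) :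
    subtreeSize s c < subtreeSize s (s c) := by
  rw [hs.subtreeSize_eq (s c), Nat.lt_succ_iff]
  exact Finset.single_le_sum (f := subtreeSize s) (fun _ _ => Nat.zero_le _)
    (mem_children.2 ⟨hc, rfl⟩)

lemma IsTree.exists_below_deviator (hs : IsTree s) {m : ℕ} (hm : StableBelow s m) (f : ℕ)
    {c : Fin (n + 1)} (hc : c ≠ 0) (hcm : subtreeSize s c < m) {z : (ℕ × ℕ) × ℕ}
    (hz : z ∈ below f 0 (subtreeSize s c)) :
    ∃ x, x ≠ 0 ∧ Reach s x c ∧ subtreeSize s x = z.2 ∧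
      0 < z.1.2 ∧ realCost s x = fracVal z.1 + realCost s c := by
  induction f generalizing c z with
  | zero => simp [below] at hz
  | succ f ih =>
    rw [below, List.mem_cons] at hz
    rcases hz with rfl | hz
    · exact ⟨c, hc, Reach.refl c, rfl, one_pos, by simp [fracVal]⟩
    · obtain ⟨b, hb, hz⟩ := List.mem_flatMap.1 hz
      obtain ⟨z', hz', rfl⟩ := List.mem_map.1 hz
      rw [List.mem_dedup, ← Multiset.mem_coe, ← hm c hcm] at hb
      obtain ⟨d, hd, rfl, rfl⟩ := exists_of_mem_childSizes hb
      obtain ⟨x, hx, hxd, hsize, hpos, hcost⟩ := ih hd ((hs.subtreeSize_lt hd).trans hcm) hz'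
      have hden : 0 < subtreeSize s d + 0 := subtreeSize_pos d
      refine ⟨x, hx, hxd.trans (Reach.next d), hsize, fracAdd_snd_pos hpos hden, ?_⟩
      rw [hcost, hs.realCost_eq hd, hm.indeg_eq hcm, fracVal_fracAdd hpos hden, add_assoc]
      rfl

lemma IsTree.exists_below_target (hs : IsTree s) {m : ℕ} (hm : StableBelow s m) (f t : ℕ)
    {c : Fin (n + 1)} (hc : c ≠ 0) (hcm : subtreeSize s c < m) {z : (ℕ × ℕ) × ℕ}
    (hz : z ∈ below f t (subtreeSize s c)) :
    ∃ y, Reach s y c ∧ subtreeSize s y = z.2 ∧ 0 < z.1.2 ∧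
      ∀ x w, x ≠ 0 → subtreeSize s x = t → ¬ Reach s x c → Reach s w y → ¬ Reach s w x →
        realCost (Function.update s x w) y ≤
          fracVal z.1 + realCost (Function.update s x w) c := by
  induction f generalizing c z with
  | zero => simp [below] at hz
  | succ f ih =>
    rw [below, List.mem_cons] at hz
    rcases hz with rfl | hz
    · exact ⟨c, Reach.refl c, rfl, one_pos, by simp [fracVal]⟩
    · obtain ⟨b, hb, hz⟩ := List.mem_flatMap.1 hz
      obtain ⟨z', hz', rfl⟩ := List.mem_map.1 hz
      rw [List.mem_dedup, ← Multiset.mem_coe, ← hm c hcm] at hb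
      obtain ⟨d, hd, rfl, rfl⟩ := exists_of_mem_childSizes hb
      obtain ⟨y, hyd, hsize, hpos, hcost⟩ := ih hd ((hs.subtreeSize_lt hd).trans hcm) hz'
      have hden : 0 < subtreeSize s d + t := Nat.add_pos_left (subtreeSize_pos d) t
      refine ⟨y, hyd.trans (Reach.next d), hsize, fracAdd_snd_pos hpos hden,
        fun x w hx ht hxd hwy hwx => ?_⟩
      have hxd' : ¬ Reach s x d := fun h => hxd (h.trans (Reach.next d))
      have hwd : Reach s w d := hwy.trans hyd
      have hdx : d ≠ x := by
        rintro rfl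
        exact hxd' (Reach.refl d)
      have hsw : s d ≠ w := by
        rintro rfl
        exact hs.not_reach_next hd hwd
      have hstep : realCost (Function.update s x w) d ≤
          fracVal ((branches (subtreeSize s (s d))).length, subtreeSize s d + t) +
            realCost (Function.update s x w) (s d) := by
        rw [(hs.update hx hwx).realCost_eq hd, update_of_ne hdx, ← hm.indeg_eq hcm]
        exact add_le_add_left (natCast_div_le_div (indeg_update_le hsw)
          (ht ▸ subtreeSize_add_le_update hwx hwd hxd') hden) _
      have := hcost x w hx ht hxd' hwy hwx
      rw [fracVal_fracAdd hpos hden]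
      linarith

lemma IsTree.not_improvable (hs : IsTree s)
    (hst : ∀ x, x ≠ 0 → ∀ y, y ≠ x → cost 0 s x ≤ cost 0 (Function.update s x y) x)
    {v : Fin (n + 1)} (hm : StableBelow s (subtreeSize s v)) {P : List ℕ}
    (hP : (P : Multiset ℕ) = childSizes s v) : ¬ improvable P = true := by
  have hreal : ∀ x y, x ≠ 0 → ¬ Reach s y x →
      realCost s x ≤ fracVal (indeg 0 s y + 1, subtreeSize s x) +
        realCost (Function.update s x y) y := by
    intro x y hx hyx
    refine le_trans ?_ (hs.realCost_update_self_le hx hyx)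
    refine ENNReal.toReal_mono (cost_ne_top ((hs.update hx hyx).reach x)) (hst x hx y ?_)
    rintro rfl
    exact hyx (Reach.refl y)
  have hdeg : indeg 0 s v = P.length := by
    rw [indeg_eq_card_childSizes, ← hP, Multiset.coe_card]
  intro h
  simp only [improvable, List.any_eq_true, Bool.or_eq_true, Bool.and_eq_true, Nat.blt_eq] at h
  obtain ⟨a, ha, z, hz, h⟩ := h
  rw [← Multiset.mem_coe, hP] at ha
  obtain ⟨c, hc, rfl, rfl⟩ := exists_of_mem_childSizes ha
  obtain ⟨x, hx, hxc, hsize, hzpos, hcost⟩ :=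
    hs.exists_below_deviator hm 16 hc (hs.subtreeSize_lt hc) hz
  have hxpos : 0 < z.2 := hsize ▸ subtreeSize_pos x
  have hcpos := subtreeSize_pos (s := s) c
  have hold : realCost s x =
      fracVal (fracAdd z.1 (P.length, subtreeSize s c)) + realCost s (s c) := by
    rw [hcost, hs.realCost_eq hc, hdeg, fracVal_fracAdd hzpos hcpos, add_assoc]
    rfl
  have holdpos := fracAdd_snd_pos (q := (P.length, subtreeSize s c)) hzpos hcpos
  have hscx : ¬ Reach s (s c) x := fun h => hs.not_reach_next hc (h.trans hxc)
  rcases h with ⟨hlt, hgain⟩ | ⟨b, hb, w, hw, hgain⟩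
  · have hdev := hreal x (s c) hx hscx
    have habove := hs.realCost_update_le hx hscx (Reach.refl _) hscx
    have hgain' := fracVal_lt hxpos holdpos hgain
    rw [hdeg, hsize] at hdev
    linarith
  · rw [← Multiset.mem_coe, ← Multiset.coe_erase, hP] at hb
    obtain ⟨d, hd, hdc, hne, rfl⟩ := exists_of_mem_childSizes_erase hc rfl hb
    have hdm : subtreeSize s d < subtreeSize s (s c) := hdc ▸ hs.subtreeSize_lt hd
    obtain ⟨y, hyd, hsize', hwpos, hcost'⟩ := hs.exists_below_target hm 16 z.2 hd hdm hw
    have hxd : ¬ Reach s x d := hs.not_reach_both hc hd hdc.symm hne.symm hxc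
    have hyx : ¬ Reach s y x := fun h =>
      hs.not_reach_both hc hd hdc.symm hne.symm (h.trans hxc) hyd
    have hym : subtreeSize s y < subtreeSize s (s c) := by
      refine lt_of_le_of_lt ?_ hdm
      rw [subtreeSize_eq_card, subtreeSize_eq_card]
      exact Finset.card_le_card fun u hu => mem_subtree.2 ((mem_subtree.1 hu).trans hyd)
    have hdev := hreal x y hx hyx
    rw [hm.indeg_eq hym, hsize, hsize'] at hdev
    have hpath := hcost' x y hx hsize hxd (Reach.refl y) hyx
    have hyc : Reach s y (s c) := hdc ▸ hyd.trans (Reach.next d)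
    have habove := hs.realCost_update_le hx hyx hyc hscx
    have hcy : s c ≠ y := by
      rintro rfl
      rw [← hdc] at hyd
      exact hs.not_reach_next hd hyd
    have hdx : d ≠ x := by
      rintro rfl
      exact hxd (Reach.refl d)
    have hdeg' : indeg 0 (Function.update s x y) (s c) ≤
        if z.2 = subtreeSize s c then P.length - 1 else P.length := by
      rw [← hdeg]
      split_ifs with heq
      · obtain rfl := hs.eq_of_subtreeSize_eq hxc (hsize.trans heq)
        exact Nat.le_sub_one_of_lt (indeg_update_add_one_le hx hcy)
      · exact indeg_update_le hcy
    have hdpos : 0 < subtreeSize s d + z.2 := Nat.add_pos_right _ hxpos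
    have hlast : realCost (Function.update s x y) d ≤
        fracVal (if z.2 = subtreeSize s c then P.length - 1 else P.length,
          subtreeSize s d + z.2) + realCost (Function.update s x y) (s c) := by
      rw [(hs.update hx hyx).realCost_eq hd, update_of_ne hdx, hdc]
      exact add_le_add_left (natCast_div_le_div hdeg'
        (hsize ▸ subtreeSize_add_le_update hyx hyd hxd) hdpos) _
    have hgain' := fracVal_lt (fracAdd_snd_pos hxpos (fracAdd_snd_pos hwpos hdpos)) holdpos hgain
    rw [fracVal_fracAdd hxpos (fracAdd_snd_pos hwpos hdpos), fracVal_fracAdd hwpos hdpos] at hgain'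
    linarith

lemma IsTree.exists_cost_update_lt {s : Fin (16 + 1) → Fin (16 + 1)} (hs : IsTree s) :
    ∃ x, x ≠ 0 ∧ ∃ y, y ≠ x ∧ cost 0 (Function.update s x y) x < cost 0 s x := by
  by_contra! hst
  have hchildren : ∀ v, subtreeSize s v < 17 ∧ childSizes s v = branches (subtreeSize s v) := by
    intro v
    induction hk : subtreeSize s v using Nat.strong_induction_on generalizing v with
    | _ k ih =>
      subst hk
      have hsize := hs.subtreeSize_eq v
      have hle : subtreeSize s v ≤ 17 := by
        rw [show 17 = subtreeSize s 0 from hs.subtreeSize_root.symm, subtreeSize_eq_card,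
          subtreeSize_eq_card]
        exact Finset.card_le_card fun w _ => mem_subtree.2 (hs.reach w)
      have hparts : ∀ a ∈ childSizes s v, 0 < a ∧ a ≤ subtreeSize s v - 1 := by
        intro a ha
        obtain ⟨c, hc, rfl, rfl⟩ := exists_of_mem_childSizes ha
        exact ⟨subtreeSize_pos c, Nat.le_sub_one_of_lt (hs.subtreeSize_lt hc)⟩
      have hsum : (childSizes s v).sum = subtreeSize s v - 1 := by
        rw [hsize, Nat.add_sub_cancel]
        rfl
      obtain ⟨P, hP, hPv⟩ := exists_mem_partitionsLE _ _ _ hparts hsum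
      have hm : StableBelow s (subtreeSize s v) := fun u hu => (ih _ hu u rfl).2
      obtain ⟨hlt, rfl⟩ := (partitions_complete _ (List.mem_range.2 (by omega)) P hP).resolve_left
        (hs.not_improvable hst hm hPv)
      rw [← hPv, Nat.sub_add_cancel (subtreeSize_pos v)]
      exact ⟨by omega, rfl⟩
  have hroot := (hchildren 0).1
  rw [hs.subtreeSize_root] at hroot
  exact absurd hroot (lt_irrefl _)

/-- For `n = 16` agents, the tree connection game admits no pure Nash
equilibrium: for every strategy profile there is an agent who can strictly decrease her
cost by unilaterally changing her strategy. -/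
theorem no_equilibrium_for_sixteen :
    ∀ s : Fin (16 + 1) → Fin (16 + 1), ValidProfile 0 s →
      ∃ v : Fin (16 + 1), v ≠ 0 ∧ ∃ w : Fin (16 + 1), w ≠ v ∧
        cost 0 (Function.update s v w) v < cost 0 s v := by
  intro s hs
  by_cases hreach : ∀ u, Reach s u 0
  · exact IsTree.exists_cost_update_lt ⟨hs.1, hreach⟩
  · push Not at hreach
    obtain ⟨u, hu⟩ := hreach
    have hu0 : u ≠ 0 := by
      rintro rfl
      exact hu (Reach.refl 0)
    refine ⟨u, hu0, 0, hu0.symm, ?_⟩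
    rw [show cost 0 s u = ⊤ from dif_neg hu, lt_top_iff_ne_top]
    exact cost_ne_top ⟨1, update_self u 0 s⟩

end TCG
end
end

section
/- In the tree connection game with n agents, for every strategy profile whose induced network T is a spanning tree directed towards the root r: (i) the social cost satisfies SC(T) = Σ_{v∈V} (indeg(v))²; (ii) SC(T) ≥ n; and (iii) SC(T) = n if and only if T is a directed Hamiltonian path ending at r. Consequently, any Hamiltonian path having the root r as one endpoint is a social optimum, and any network in which at least one node has in-degree at least 2 has social cost at least n + 2. -/
open Function
open scoped ENNReal Classical

noncomputable section

namespace TCG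

variable {n : ℕ}

/-- `s` induces a directed Hamiltonian path ending at the root: the nodes can be
enumerated `r = u_0, u_1, …, u_n` with each agent `u_{i+1}` activating the edge
`(u_{i+1}, u_i)`. -/
def IsHamPath (s : Fin (n + 1) → Fin (n + 1)) : Prop :=
  ∃ e : Fin (n + 1) ≃ Fin (n + 1), e 0 = 0 ∧
    ∀ i : Fin n, s (e i.succ) = e i.castSucc

theorem card_filter_eq_indeg (s : Fin (n + 1) → Fin (n + 1)) (v : Fin (n + 1)) :
    ((Finset.univ.erase (0 : Fin (n + 1))).filter fun u => s u = v).card = indeg 0 s v := by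
  rw [indeg, Nat.card_eq_card_toFinset]
  congr 1
  ext u
  simp

theorem sum_indeg (s : Fin (n + 1) → Fin (n + 1)) : ∑ v, indeg 0 s v = n := by
  have h := Finset.card_eq_sum_card_fiberwise (f := s)
    (s := Finset.univ.erase (0 : Fin (n + 1))) (t := Finset.univ) (by simp)
  rw [Finset.card_erase_of_mem (Finset.mem_univ _), Finset.card_univ, Fintype.card_fin,
    Nat.add_sub_cancel] at h
  exact (Finset.sum_congr rfl fun v _ => (card_filter_eq_indeg s v).symm).trans h.symm

theorem indeg_le_one_iff (s : Fin (n + 1) → Fin (n + 1)) :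
    (∀ v, indeg 0 s v ≤ 1) ↔ ∀ u u', u ≠ 0 → u' ≠ 0 → s u = s u' → u = u' := by
  constructor
  · intro h u u' hu hu' huu
    have := h (s u')
    rw [indeg, Finite.card_le_one_iff_subsingleton] at this
    exact congrArg Subtype.val (this.elim ⟨u, hu, huu⟩ ⟨u', hu', rfl⟩)
  · intro h v
    rw [indeg, Finite.card_le_one_iff_subsingleton]
    exact ⟨fun a b => Subtype.ext (h _ _ a.2.1 b.2.1 (a.2.2.trans b.2.2.symm))⟩

theorem injOn_iterate_find {s : Fin (n + 1) → Fin (n + 1)} {v : Fin (n + 1)}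
    (h : ∃ k, s^[k] v = 0) :
    Set.InjOn (fun k => s^[k] v) (Finset.range (Nat.find h + 1)) := by
  have key : ∀ i j, i < j → j ≤ Nat.find h → s^[i] v ≠ s^[j] v := by
    intro i j hij hj heq
    refine Nat.find_min h (m := Nat.find h - j + i) (by omega) ?_
    rw [iterate_add_apply, heq, ← iterate_add_apply, Nat.sub_add_cancel hj]
    exact Nat.find_spec h
  intro i hi j hj hij
  simp only [Finset.coe_range, Set.mem_Iio] at hi hj
  rcases lt_trichotomy i j with hlt | heq | hlt
  · exact absurd hij (key i j hlt (by omega))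
  · exact heq
  · exact absurd hij.symm (key j i hlt (by omega))

theorem cost_eq_sum {s : Fin (n + 1) → Fin (n + 1)} (hroot : s 0 = 0) {v : Fin (n + 1)}
    (h : ∃ k, s^[k] v = 0) :
    cost 0 s v = ∑ u ∈ Finset.univ.erase (0 : Fin (n + 1)),
      if ∃ k, s^[k] v = u then (indeg 0 s (s u) : ℝ≥0∞) / (subtreeSize s u : ℝ≥0∞) else 0 := by
  rw [cost, dif_pos h, ← Finset.sum_filter]
  refine Finset.sum_bij (fun k _ => s^[k] v) ?_ ?_ ?_ ?_
  · intro k hk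
    simpa using Nat.find_min h (Finset.mem_range.mp hk)
  · intro i hi j hj hij
    have hsub := Finset.range_subset_range.mpr (Nat.le_succ (Nat.find h))
    exact injOn_iterate_find h (hsub hi) (hsub hj) hij
  · intro u hu
    simp only [Finset.mem_filter, Finset.mem_erase, Finset.mem_univ, and_true] at hu
    obtain ⟨hu, k, rfl⟩ := hu
    refine ⟨k, ?_, rfl⟩
    by_contra hk
    rw [Finset.mem_range, not_lt] at hk
    apply hu
    rw [← Nat.sub_add_cancel hk, iterate_add_apply, Nat.find_spec h, iterate_fixed hroot]
  · intro k _
    rw [iterate_succ_apply']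

theorem SC_eq_sum_sq {s : Fin (n + 1) → Fin (n + 1)} (hroot : s 0 = 0)
    (htree : ∀ v, ∃ k, s^[k] v = 0) :
    SC s = ((∑ v, indeg 0 s v ^ 2 : ℕ) : ℝ≥0∞) := by
  have hcol : ∀ u ∈ Finset.univ.erase (0 : Fin (n + 1)),
      (∑ v ∈ Finset.univ.erase (0 : Fin (n + 1)), if ∃ k, s^[k] v = u then
        (indeg 0 s (s u) : ℝ≥0∞) / (subtreeSize s u : ℝ≥0∞) else 0) = indeg 0 s (s u) := by
    intro u hu
    have hu0 : u ≠ 0 := Finset.ne_of_mem_erase hu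
    have hcard : ((Finset.univ.erase (0 : Fin (n + 1))).filter fun v => ∃ k, s^[k] v = u).card
        = subtreeSize s u := by
      rw [subtreeSize, Nat.card_eq_card_toFinset]
      congr 1
      ext v
      simp only [Finset.mem_filter, Finset.mem_erase, Finset.mem_univ, and_true,
        Set.mem_toFinset, Set.mem_ofPred_eq, and_iff_right_iff_imp]
      rintro ⟨k, hk⟩ rfl
      exact hu0 (hk.symm.trans (iterate_fixed hroot k))
    have hpos : (subtreeSize s u : ℝ≥0∞) ≠ 0 := by
      rw [← hcard, Nat.cast_ne_zero]
      exact Finset.card_ne_zero.mpr ⟨u, Finset.mem_filter.mpr ⟨hu, 0, rfl⟩⟩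
    rw [← Finset.sum_filter, Finset.sum_const, hcard, nsmul_eq_mul,
      ENNReal.mul_div_cancel hpos (ENNReal.natCast_ne_top _)]
  rw [SC, Finset.sum_congr rfl fun v _ => cost_eq_sum hroot (htree v), Finset.sum_comm,
    Finset.sum_congr rfl hcol, ← Nat.cast_sum]
  congr 1
  rw [← Finset.sum_fiberwise (Finset.univ.erase (0 : Fin (n + 1))) s]
  refine Finset.sum_congr rfl fun v _ => ?_
  rw [Finset.sum_congr rfl (g := fun _ => indeg 0 s v)
    fun u hu => by rw [(Finset.mem_filter.mp hu).2], Finset.sum_const, card_filter_eq_indeg,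
    smul_eq_mul, sq]

theorem sum_sq_indeg (s : Fin (n + 1) → Fin (n + 1)) :
    ∑ v, indeg 0 s v ^ 2 = n + ∑ v, indeg 0 s v * (indeg 0 s v - 1) := by
  refine Eq.trans ?_ (congrArg (· + ∑ v, indeg 0 s v * (indeg 0 s v - 1)) (sum_indeg s))
  rw [← Finset.sum_add_distrib]
  refine Finset.sum_congr rfl fun v _ => ?_
  cases indeg 0 s v with
  | zero => rfl
  | succ d => rw [Nat.add_sub_cancel]; ring

theorem sum_sq_indeg_eq_iff (s : Fin (n + 1) → Fin (n + 1)) :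
    ∑ v, indeg 0 s v ^ 2 = n ↔ ∀ v, indeg 0 s v ≤ 1 := by
  rw [sum_sq_indeg, Nat.add_eq_left, Finset.sum_eq_zero_iff]
  refine forall_congr' fun v => ?_
  simp only [Finset.mem_univ, forall_const, mul_eq_zero]
  omega

theorem find_eq_succ {s : Fin (n + 1) → Fin (n + 1)} (htree : ∀ v, ∃ k, s^[k] v = 0)
    {u : Fin (n + 1)} (hu : u ≠ 0) :
    Nat.find (htree u) = Nat.find (htree (s u)) + 1 :=
  Nat.find_comp_succ (htree u) (htree (s u)) hu

theorem find_injective {s : Fin (n + 1) → Fin (n + 1)} (htree : ∀ v, ∃ k, s^[k] v = 0)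
    (hinj : ∀ u u', u ≠ 0 → u' ≠ 0 → s u = s u' → u = u') :
    Injective fun v => Nat.find (htree v) := by
  have key : ∀ k u u', Nat.find (htree u) = k → Nat.find (htree u') = k → u = u' := by
    intro k
    induction k with
    | zero =>
      intro u u' hu hu'
      rw [Nat.find_eq_zero] at hu hu'
      exact hu.trans hu'.symm
    | succ k ih =>
      intro u u' hu hu'
      have hne : ∀ w, Nat.find (htree w) = k + 1 → w ≠ 0 := by
        rintro w hw rfl
        exact absurd (((Nat.find_eq_zero (htree 0)).mpr rfl).symm.trans hw) (by omega)
      have hu0 := hne u hu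
      have hu0' := hne u' hu'
      rw [find_eq_succ htree hu0] at hu
      rw [find_eq_succ htree hu0'] at hu'
      exact hinj u u' hu0 hu0' (ih _ _ (by omega) (by omega))
  exact fun u u' h => key _ u u' h rfl

theorem isHamPath_iff {s : Fin (n + 1) → Fin (n + 1)} (htree : ∀ v, ∃ k, s^[k] v = 0) :
    IsHamPath s ↔ ∀ v, indeg 0 s v ≤ 1 := by
  rw [indeg_le_one_iff]
  constructor
  · rintro ⟨e, he0, he⟩ u u' hu hu' huu
    have hsucc : ∀ w, w ≠ 0 → ∃ i : Fin n, e i.succ = w := by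
      intro w hw
      obtain ⟨i, hi⟩ := Fin.exists_succ_eq.mpr (show e.symm w ≠ 0 by
        rwa [Ne, Equiv.symm_apply_eq, he0])
      exact ⟨i, by rw [hi, Equiv.apply_symm_apply]⟩
    obtain ⟨i, rfl⟩ := hsucc u hu
    obtain ⟨j, rfl⟩ := hsucc u' hu'
    rw [he, he] at huu
    rw [Fin.castSucc_injective n (e.injective huu)]
  · intro hinj
    have hlt : ∀ v, Nat.find (htree v) < n + 1 := by
      intro v
      have := Finset.card_le_card_of_injOn (t := Finset.univ) _ (by simp)
        (injOn_iterate_find (htree v))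
      rw [Finset.card_range, Finset.card_univ, Fintype.card_fin] at this
      omega
    let depth : Fin (n + 1) → Fin (n + 1) := fun v => ⟨Nat.find (htree v), hlt v⟩
    have hdepth : Injective depth := fun u u' h =>
      find_injective htree hinj (congrArg Fin.val h)
    let d := Equiv.ofBijective depth (Finite.injective_iff_bijective.mp hdepth)
    have hd0 : d 0 = 0 := Fin.ext ((Nat.find_eq_zero _).mpr rfl)
    refine ⟨d.symm, by rw [Equiv.symm_apply_eq, hd0], fun i => ?_⟩
    rw [Equiv.eq_symm_apply]
    have hu : d.symm i.succ ≠ 0 := by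
      rw [Ne, Equiv.symm_apply_eq, hd0]
      exact Fin.succ_ne_zero i
    have h1 : (d (d.symm i.succ)).val = (d (s (d.symm i.succ))).val + 1 := find_eq_succ htree hu
    rw [Equiv.apply_symm_apply, Fin.val_succ] at h1
    exact Fin.ext (by rw [Fin.val_castSucc]; omega)

/-- For every spanning-tree profile with `n` agents:
(i) the social cost equals `Σ_v indeg(v)²`; (ii) `SC(T) ≥ n`;
(iii) `SC(T) = n` iff `T` is a directed Hamiltonian path ending at `r`;
consequently any Hamiltonian path ending at `r` is a social optimum, and
any network with a node of in-degree at least `2` has social cost at least `n + 2`. -/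
theorem social_cost_characterization {n : ℕ} (s : Fin (n + 1) → Fin (n + 1))
    (hvalid : ValidProfile 0 s) (htree : ∀ v, ∃ k, s^[k] v = 0) :
    SC s = ∑ v : Fin (n + 1), (indeg 0 s v : ℝ≥0∞) ^ 2 ∧
    (n : ℝ≥0∞) ≤ SC s ∧
    (SC s = (n : ℝ≥0∞) ↔ IsHamPath s) ∧
    (IsHamPath s → ∀ s' : Fin (n + 1) → Fin (n + 1),
      ValidProfile 0 s' → (∀ v, ∃ k, s'^[k] v = 0) → SC s ≤ SC s') ∧
    ((∃ v, 2 ≤ indeg 0 s v) → (n : ℝ≥0∞) + 2 ≤ SC s) := by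
  have hSC := SC_eq_sum_sq hvalid.1 htree
  have hle : ∀ s' : Fin (n + 1) → Fin (n + 1), n ≤ ∑ v, indeg 0 s' v ^ 2 := fun s' => by
    rw [sum_sq_indeg]
    exact Nat.le_add_right _ _
  have hiff : SC s = (n : ℝ≥0∞) ↔ IsHamPath s := by
    rw [hSC, Nat.cast_inj, sum_sq_indeg_eq_iff, isHamPath_iff htree]
  refine ⟨by rw [hSC]; push_cast; rfl, ?_, hiff, ?_, ?_⟩
  · rw [hSC]
    exact_mod_cast hle s
  · intro hpath s' hvalid' htree'
    rw [hiff.mpr hpath, SC_eq_sum_sq hvalid'.1 htree']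
    exact_mod_cast hle s'
  · rintro ⟨v, hv⟩
    have h2 : n + 2 ≤ ∑ v, indeg 0 s v ^ 2 := by
      rw [sum_sq_indeg]
      have hv2 : 2 * 1 ≤ indeg 0 s v * (indeg 0 s v - 1) := Nat.mul_le_mul hv (by omega)
      have := Finset.single_le_sum (f := fun v => indeg 0 s v * (indeg 0 s v - 1))
        (fun _ _ => Nat.zero_le _) (Finset.mem_univ v)
      omega
    rw [hSC]
    exact_mod_cast h2

end TCG
end
end
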